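/- Let n ≥ 2 and let Ĩ be an independent set of the Birkhoff polytope graph G(Ω_n) all of whose elements are even permutations. For σ ∈ Ĩ and ρ ∈ Sym(n), let σρ ⊕ ρ denote the permutation of {1,…,2n} acting as σ∘ρ on {1,…,n} and sending n+i ↦ n+ρ(i) for 1 ≤ i ≤ n, and set L̃ = { σρ ⊕ ρ : σ ∈ Ĩ, ρ ∈ Sym(n) }. Fix w ∈ Sym(n) which is an even permutation if n is even and an odd permutation if n is odd, and let H ∈ Sym(2n) be the permutation sending i ↦ n+i for 1 ≤ i ≤ n and n+j ↦ w(j) for 1 ≤ j ≤ n. Then L̃ ∪ { X∘H : X ∈ L̃ } is an independent set of G(Ω_{2n}) consisting of 2·n!·|Ĩ| even permutations. -/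

import Mathlib

/-- An independent set of the Birkhoff polytope graph `G(Ω_n)`: a set of pairwise
non-adjacent permutations, where `σ`, `τ` are adjacent iff `σ⁻¹ * τ` is a cycle. -/
def IsBIndep {n : ℕ} (S : Set (Equiv.Perm (Fin n))) : Prop :=
  S.Pairwise fun σ τ => ¬ (σ⁻¹ * τ).IsCycle

/-- The direct sum `x ⊕ y` of two permutations, acting as `x` on the block
`{0,…,a-1}` and as `y` on the block `{a,…,a+b-1}`. -/
def permOplus {a b : ℕ} (x : Equiv.Perm (Fin a)) (y : Equiv.Perm (Fin b)) :
    Equiv.Perm (Fin (a + b)) :=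
  finSumFinEquiv.symm.trans ((Equiv.sumCongr x y).trans finSumFinEquiv)

/-- The permutation `H` of `{0,…,2n-1}` sending `i ↦ n + i` for `i < n` and
`n + j ↦ w j` for `j < n`. -/
def permHmix (n : ℕ) (w : Equiv.Perm (Fin n)) : Equiv.Perm (Fin (n + n)) :=
  finSumFinEquiv.symm.trans
    (((Equiv.sumCongr (1 : Equiv.Perm (Fin n)) w).trans
      (Equiv.sumComm (Fin n) (Fin n))).trans finSumFinEquiv)

lemma permOplus_castAdd {a b : ℕ} (x : Equiv.Perm (Fin a)) (y : Equiv.Perm (Fin b)) (i : Fin a) :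
    permOplus x y (Fin.castAdd b i) = Fin.castAdd b (x i) := by
  simp [permOplus]

lemma permOplus_natAdd {a b : ℕ} (x : Equiv.Perm (Fin a)) (y : Equiv.Perm (Fin b)) (i : Fin b) :
    permOplus x y (Fin.natAdd a i) = Fin.natAdd a (y i) := by
  simp [permOplus]

lemma permHmix_castAdd (n : ℕ) (w : Equiv.Perm (Fin n)) (i : Fin n) :
    permHmix n w (Fin.castAdd n i) = Fin.natAdd n i := by
  simp [permHmix]

lemma permHmix_natAdd (n : ℕ) (w : Equiv.Perm (Fin n)) (i : Fin n) :
    permHmix n w (Fin.natAdd n i) = Fin.castAdd n (w i) := by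
  simp only [permHmix, Equiv.trans_apply, finSumFinEquiv_symm_apply_natAdd]
  simp

lemma castAdd_ne_natAdd {a b : ℕ} (i : Fin a) (j : Fin b) :
    Fin.castAdd b i ≠ Fin.natAdd a j := by
  intro h
  have h1 := congrArg Fin.val h
  have h2 := i.isLt
  simp only [Fin.val_castAdd, Fin.val_natAdd] at h1
  omega

lemma permOplus_mul {a b : ℕ} (x x' : Equiv.Perm (Fin a)) (y y' : Equiv.Perm (Fin b)) :
    permOplus x y * permOplus x' y' = permOplus (x * x') (y * y') := by
  ext z
  refine Fin.addCases (fun i => ?_) (fun i => ?_) z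
  · simp only [Equiv.Perm.mul_apply, permOplus_castAdd]
  · simp only [Equiv.Perm.mul_apply, permOplus_natAdd]

lemma permOplus_one {a b : ℕ} :
    permOplus (1 : Equiv.Perm (Fin a)) (1 : Equiv.Perm (Fin b)) = 1 := by
  ext z
  refine Fin.addCases (fun i => ?_) (fun i => ?_) z
  · simp only [permOplus_castAdd, Equiv.Perm.one_apply]
  · simp only [permOplus_natAdd, Equiv.Perm.one_apply]

/-- The direct sum as a group homomorphism. -/
def permOplusHom (a b : ℕ) :
    Equiv.Perm (Fin a) × Equiv.Perm (Fin b) →* Equiv.Perm (Fin (a + b)) where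
  toFun p := permOplus p.1 p.2
  map_one' := permOplus_one
  map_mul' _ _ := (permOplus_mul _ _ _ _).symm

lemma permOplus_inv {a b : ℕ} (x : Equiv.Perm (Fin a)) (y : Equiv.Perm (Fin b)) :
    (permOplus x y)⁻¹ = permOplus x⁻¹ y⁻¹ :=
  (map_inv (permOplusHom a b) (x, y)).symm

lemma permOplus_zpow {a b : ℕ} (x : Equiv.Perm (Fin a)) (y : Equiv.Perm (Fin b)) (k : ℤ) :
    (permOplus x y) ^ k = permOplus (x ^ k) (y ^ k) :=
  (map_zpow (permOplusHom a b) (x, y) k).symm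

lemma permOplus_inj {a b : ℕ} {x x' : Equiv.Perm (Fin a)} {y y' : Equiv.Perm (Fin b)}
    (h : permOplus x y = permOplus x' y') : x = x' ∧ y = y' := by
  constructor
  · ext1 i
    have h1 := congrArg (fun f => f (Fin.castAdd b i)) h
    simp only [permOplus_castAdd] at h1
    exact Fin.castAdd_injective _ _ h1
  · ext1 i
    have h1 := congrArg (fun f => f (Fin.natAdd a i)) h
    simp only [permOplus_natAdd] at h1
    exact Fin.natAdd_injective _ _ h1

lemma sign_permOplus {a b : ℕ} (x : Equiv.Perm (Fin a)) (y : Equiv.Perm (Fin b)) :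
    Equiv.Perm.sign (permOplus x y) = Equiv.Perm.sign x * Equiv.Perm.sign y := by
  rw [← Equiv.Perm.sign_sumCongr]
  exact Equiv.Perm.sign_symm_trans_trans (Equiv.Perm.sumCongr x y) finSumFinEquiv

lemma permHmix_eq (n : ℕ) (w : Equiv.Perm (Fin n)) :
    permHmix n w = permHmix n 1 * permOplus 1 w := by
  ext z
  refine Fin.addCases (fun i => ?_) (fun i => ?_) z
  · simp only [Equiv.Perm.mul_apply, permOplus_castAdd, permHmix_castAdd, Equiv.Perm.one_apply]
  · simp only [Equiv.Perm.mul_apply, permOplus_natAdd, permHmix_natAdd, Equiv.Perm.one_apply]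

lemma permOplus_mul_permHmix_ne {n : ℕ} (x y w : Equiv.Perm (Fin n)) (z : Fin (n + n)) :
    (permOplus x y * permHmix n w) z ≠ z := by
  refine Fin.addCases (fun i => ?_) (fun i => ?_) z
  · rw [Equiv.Perm.mul_apply, permHmix_castAdd, permOplus_natAdd]
    exact (castAdd_ne_natAdd _ _).symm
  · rw [Equiv.Perm.mul_apply, permHmix_natAdd, permOplus_castAdd]
    exact castAdd_ne_natAdd _ _

lemma sign_permHmix_one (n : ℕ) : Equiv.Perm.sign (permHmix n 1) = (-1) ^ n := by
  have h2 : permHmix n 1 ^ 2 = 1 := by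
    rw [sq]
    ext z
    refine Fin.addCases (fun i => ?_) (fun i => ?_) z
    · simp only [Equiv.Perm.mul_apply, permHmix_castAdd, permHmix_natAdd, Equiv.Perm.one_apply]
    · simp only [Equiv.Perm.mul_apply, permHmix_castAdd, permHmix_natAdd, Equiv.Perm.one_apply]
  rw [Equiv.Perm.sign_of_pow_two_eq_one h2]
  have h3 : IsEmpty (Function.fixedPoints (permHmix n 1)) := by
    refine ⟨fun z => ?_⟩
    have := permOplus_mul_permHmix_ne 1 1 1 z.1
    rw [permOplus_one, one_mul] at this
    exact this z.2
  rw [Fintype.card_fin, Fintype.card_eq_zero]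
  congr 1
  omega

lemma sign_permHmix (n : ℕ) (w : Equiv.Perm (Fin n))
    (hw : Equiv.Perm.sign w = if Even n then 1 else -1) :
    Equiv.Perm.sign (permHmix n w) = 1 := by
  rw [permHmix_eq, Equiv.Perm.sign_mul, sign_permOplus, sign_permHmix_one, hw]
  split_ifs with h
  · simp [h.neg_one_pow]
  · simp [(Nat.not_even_iff_odd.mp h).neg_one_pow]

lemma isCycle_permOplus {a b : ℕ} {x : Equiv.Perm (Fin a)} {y : Equiv.Perm (Fin b)}
    (h : (permOplus x y).IsCycle) : (y = 1 ∧ x.IsCycle) ∨ (x = 1 ∧ y.IsCycle) := by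
  obtain ⟨z, hz, hc⟩ := h
  revert hz hc
  refine Fin.addCases (fun i => ?_) (fun i => ?_) z
  · intro hz hc
    left
    constructor
    · ext1 j
      by_contra hj
      obtain ⟨k, hk⟩ := hc (y := Fin.natAdd a j) (by
        rw [permOplus_natAdd]
        exact fun e => hj (Fin.natAdd_injective _ _ e))
      rw [permOplus_zpow, permOplus_castAdd] at hk
      exact castAdd_ne_natAdd _ _ hk
    · refine ⟨i, fun e => hz (by rw [permOplus_castAdd, e]), fun j hj => ?_⟩
      obtain ⟨k, hk⟩ := hc (y := Fin.castAdd b j) (by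
        rw [permOplus_castAdd]
        exact fun e => hj (Fin.castAdd_injective _ _ e))
      rw [permOplus_zpow, permOplus_castAdd] at hk
      exact ⟨k, Fin.castAdd_injective _ _ hk⟩
  · intro hz hc
    right
    constructor
    · ext1 j
      by_contra hj
      obtain ⟨k, hk⟩ := hc (y := Fin.castAdd b j) (by
        rw [permOplus_castAdd]
        exact fun e => hj (Fin.castAdd_injective _ _ e))
      rw [permOplus_zpow, permOplus_natAdd] at hk
      exact castAdd_ne_natAdd _ _ hk.symm
    · refine ⟨i, fun e => hz (by rw [permOplus_natAdd, e]), fun j hj => ?_⟩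
      obtain ⟨k, hk⟩ := hc (y := Fin.natAdd a j) (by
        rw [permOplus_natAdd]
        exact fun e => hj (Fin.natAdd_injective _ _ e))
      rw [permOplus_zpow, permOplus_natAdd] at hk
      exact ⟨k, Fin.natAdd_injective _ _ hk⟩

lemma not_isCycle_mix {n : ℕ} (x y w : Equiv.Perm (Fin n))
    (hs : Equiv.Perm.sign (permOplus x y * permHmix n w) = 1) :
    ¬ (permOplus x y * permHmix n w).IsCycle := by
  intro hc
  have h1 := hc.sign
  have h2 : (permOplus x y * permHmix n w).support = Finset.univ := by
    ext z
    simp only [Equiv.Perm.mem_support, Finset.mem_univ, iff_true]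
    exact permOplus_mul_permHmix_ne x y w z
  rw [h2, hs, Finset.card_univ, Fintype.card_fin, Even.neg_one_pow ⟨n, rfl⟩] at h1
  exact absurd h1 (by decide)

lemma not_isCycle_block {n : ℕ} {I : Set (Equiv.Perm (Fin n))} (hI : IsBIndep I)
    {σ τ : Equiv.Perm (Fin n)} (hσ : σ ∈ I) (hτ : τ ∈ I) (ρ μ : Equiv.Perm (Fin n)) :
    ¬ ((permOplus (σ * ρ) ρ)⁻¹ * permOplus (τ * μ) μ).IsCycle := by
  intro hc
  have key : ¬ (σ⁻¹ * τ).IsCycle := by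
    intro h
    by_cases e : σ = τ
    · subst e
      rw [inv_mul_cancel] at h
      exact h.ne_one rfl
    · exact hI hσ hτ e h
  rw [permOplus_inv, permOplus_mul] at hc
  rcases isCycle_permOplus hc with ⟨h1, h2⟩ | ⟨h1, h2⟩
  · have e : ρ = μ := inv_mul_eq_one.mp h1
    subst e
    apply key
    have h3 := h2.conj (g := ρ)
    have h4 : ρ * ((σ * ρ)⁻¹ * (τ * ρ)) * ρ⁻¹ = σ⁻¹ * τ := by group
    rwa [h4] at h3
  · have e : σ * ρ = τ * μ := inv_mul_eq_one.mp h1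
    apply key
    have h3 := (h2.conj (g := ρ)).inv
    have h4 : (ρ * (ρ⁻¹ * μ) * ρ⁻¹)⁻¹ = σ⁻¹ * τ := by
      have e2 : ρ = σ⁻¹ * (τ * μ) := by rw [← e]; group
      have e3 : (ρ * (ρ⁻¹ * μ) * ρ⁻¹)⁻¹ = ρ * μ⁻¹ := by group
      rw [e3, e2]; group
    rwa [h4] at h3

/-- Proposition 4.4 (c): if `Ĩ` is an independent set of `G(Ω_n)` of even permutations,
`L̃ = { (σ·ρ) ⊕ ρ : σ ∈ Ĩ, ρ ∈ Sym(n) }`, and `w ∈ Sym(n)` is even or odd according as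
`n` is even or odd, then `L̃ ∪ L̃·H` (with `H` the block mixing permutation) is an
independent set of `G(Ω_{2n})` consisting of `2·n!·|Ĩ|` even permutations. -/
theorem stmt15 (n : ℕ) (hn : 2 ≤ n)
    (I : Set (Equiv.Perm (Fin n))) (hI : IsBIndep I)
    (heven : ∀ σ ∈ I, Equiv.Perm.sign σ = 1)
    (w : Equiv.Perm (Fin n))
    (hw : Equiv.Perm.sign w = if Even n then 1 else -1)
    (L : Set (Equiv.Perm (Fin (n + n))))
    (hL : L = {π | ∃ σ ∈ I, ∃ ρ : Equiv.Perm (Fin n), π = permOplus (σ * ρ) ρ}) :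
    IsBIndep (L ∪ (fun X => X * permHmix n w) '' L) ∧
    (∀ π ∈ L ∪ (fun X => X * permHmix n w) '' L, Equiv.Perm.sign π = 1) ∧
    (L ∪ (fun X => X * permHmix n w) '' L).ncard = 2 * (n.factorial * I.ncard) := by
  have hH := sign_permHmix n w hw
  have hsL : ∀ X ∈ L, Equiv.Perm.sign X = 1 := by
    intro X hX
    rw [hL] at hX
    obtain ⟨σ, hσ, ρ, rfl⟩ := hX
    rw [sign_permOplus, Equiv.Perm.sign_mul, heven σ hσ, one_mul, Int.units_mul_self]
  have hmix : ∀ X ∈ L, ∀ Y ∈ L, ∃ x y, X⁻¹ * Y = permOplus x y := by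
    intro X hX Y hY
    rw [hL] at hX hY
    obtain ⟨σ, hσ, ρ, rfl⟩ := hX
    obtain ⟨τ, hτ, μ, rfl⟩ := hY
    exact ⟨_, _, by rw [permOplus_inv, permOplus_mul]⟩
  have hLL : ∀ X ∈ L, ∀ Y ∈ L, ¬ (X⁻¹ * Y).IsCycle := by
    intro X hX Y hY
    rw [hL] at hX hY
    obtain ⟨σ, hσ, ρ, rfl⟩ := hX
    obtain ⟨τ, hτ, μ, rfl⟩ := hY
    exact not_isCycle_block hI hσ hτ ρ μ
  have hLH : ∀ X ∈ L, ∀ Y ∈ L, ¬ (X⁻¹ * (Y * permHmix n w)).IsCycle := by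
    intro X hX Y hY
    obtain ⟨x, y, hxy⟩ := hmix X hX Y hY
    rw [← mul_assoc, hxy]
    apply not_isCycle_mix
    rw [← hxy, Equiv.Perm.sign_mul, Equiv.Perm.sign_mul, Equiv.Perm.sign_inv, hsL X hX,
      hsL Y hY, hH]
    rfl
  refine ⟨?_, ?_, ?_⟩
  · rintro X (hX | ⟨X, hX, rfl⟩) Y (hY | ⟨Y, hY, rfl⟩) -
    · exact hLL X hX Y hY
    · exact hLH X hX Y hY
    · intro hc
      apply hLH Y hY X hX
      have := hc.inv
      rwa [mul_inv_rev, inv_inv] at this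
    · intro hc
      apply hLL X hX Y hY
      have h3 := hc.conj (g := permHmix n w)
      have h4 : permHmix n w * ((X * permHmix n w)⁻¹ * (Y * permHmix n w)) * (permHmix n w)⁻¹
          = X⁻¹ * Y := by group
      exact h4 ▸ h3
  · rintro X (hX | ⟨X, hX, rfl⟩)
    · exact hsL X hX
    · simp only [Equiv.Perm.sign_mul, hsL X hX, hH, mul_one]
  · have hdisj : Disjoint L ((fun X => X * permHmix n w) '' L) := by
      rw [Set.disjoint_left]
      rintro X hX ⟨Y, hY, hYX⟩
      obtain ⟨x, y, hxy⟩ := hmix X hX Y hY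
      have h1 : permOplus x y * permHmix n w = 1 := by
        rw [← hxy, mul_assoc]
        exact inv_mul_eq_one.mpr hYX.symm
      apply permOplus_mul_permHmix_ne x y w ⟨0, by omega⟩
      rw [h1]
      rfl
    rw [Set.ncard_union_eq hdisj (Set.toFinite _) (Set.toFinite _),
      Set.ncard_image_of_injective _ (mul_left_injective _)]
    have hcard : L.ncard = I.ncard * n.factorial := by
      have h1 : L = (fun p : Equiv.Perm (Fin n) × Equiv.Perm (Fin n) =>
          permOplus (p.1 * p.2) p.2) '' (I ×ˢ Set.univ) := by
        rw [hL]
        ext π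
        constructor
        · rintro ⟨σ, hσ, ρ, rfl⟩
          exact ⟨(σ, ρ), ⟨hσ, Set.mem_univ _⟩, rfl⟩
        · rintro ⟨⟨σ, ρ⟩, ⟨hσ, -⟩, rfl⟩
          exact ⟨σ, hσ, ρ, rfl⟩
      rw [h1, Set.ncard_image_of_injective, Set.ncard_prod, Set.ncard_univ, Nat.card_eq_fintype_card,
        Fintype.card_perm, Fintype.card_fin]
      rintro ⟨σ, ρ⟩ ⟨τ, μ⟩ h
      obtain ⟨h2, h3⟩ := permOplus_inj h
      dsimp only at h2 h3
      subst h3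
      rw [mul_right_cancel h2]
    rw [hcard]
    ring
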